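/- The factor V/J₂ is simple under the two operators: every subspace W with J₂ ⊆ W ⊆ V, A(W) ⊆ W and B(W) ⊆ W equals J₂ or V. Consequently, together with the invariance and simplicity of the lower factors, 0 ⊂ J₁ ⊂ J₂ ⊂ V is a composition series of V for the subalgebra of End_ℂ(V) generated by A and B. -/

import Mathlib

noncomputable section

/-- Index set for the GTA basis: `x⁺_s` (s = 1..p), `x⁻_s` (s = 1..p), `g_s` (s = 1..p-1). -/
abbrev GTAIdx (p : ℕ) := (Fin p ⊕ Fin p) ⊕ Fin (p - 1)

/-- The underlying (3p-1)-dimensional complex vector space. -/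
abbrev GTA (p : ℕ) := GTAIdx p → ℂ

/-- `ε = exp(iπ/2p)`. -/
def eps (p : ℕ) : ℂ := Complex.exp (Real.pi * Complex.I / (2 * p))

/-- The basis vector `x⁺_s` for `1 ≤ s ≤ p`, and `0` otherwise. -/
def xp (p : ℕ) (s : ℕ) : GTA p :=
  if h : 1 ≤ s ∧ s ≤ p then Pi.single (Sum.inl (Sum.inl ⟨s - 1, by omega⟩)) 1 else 0

/-- The basis vector `x⁻_s` for `1 ≤ s ≤ p`, and `0` otherwise. -/
def xm (p : ℕ) (s : ℕ) : GTA p :=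
  if h : 1 ≤ s ∧ s ≤ p then Pi.single (Sum.inl (Sum.inr ⟨s - 1, by omega⟩)) 1 else 0

/-- The basis vector `g_s` for `1 ≤ s ≤ p-1`, and `0` otherwise. -/
def gv (p : ℕ) (s : ℕ) : GTA p :=
  if h : 1 ≤ s ∧ s ≤ p - 1 then Pi.single (Sum.inr ⟨s - 1, by omega⟩) 1 else 0

/-- The quantum integer `[s] = (ε^{2s} - ε^{-2s})/(ε² - ε^{-2})`. -/
def br (p : ℕ) (s : ℕ) : ℂ :=
  ((eps p) ^ (2 * s) - (eps p)⁻¹ ^ (2 * s)) / ((eps p) ^ 2 - (eps p)⁻¹ ^ 2)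

/-- The operator `A` (action of the curve `a`) in the GTA basis. -/
def Aop (p : ℕ) : Module.End ℂ (GTA p) :=
  (Pi.basisFun ℂ (GTAIdx p)).constr ℂ fun i =>
    match i with
    | .inl (.inl i) =>
        (-((eps p) ^ (2 * (i.1 + 1)) + (eps p)⁻¹ ^ (2 * (i.1 + 1)))) • xp p (i.1 + 1)
    | .inl (.inr i) =>
        (((eps p) ^ (2 * (i.1 + 1)) + (eps p)⁻¹ ^ (2 * (i.1 + 1)))) • xm p (i.1 + 1)
    | .inr i =>
        (-((eps p) ^ (2 * (i.1 + 1)) + (eps p)⁻¹ ^ (2 * (i.1 + 1)))) • gv p (i.1 + 1)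
          - (((eps p) ^ 2 - (eps p)⁻¹ ^ 2) ^ 2) • (xp p (i.1 + 1) + xm p (p - (i.1 + 1)))

/-- The operator `B` (action of the curve `b`) in the GTA basis. -/
def Bop (p : ℕ) : Module.End ℂ (GTA p) :=
  (Pi.basisFun ℂ (GTAIdx p)).constr ℂ fun i =>
    match i with
    | .inl (.inl i) =>
        if i.1 + 1 = p then (2 : ℂ) • xp p (p - 1) + (2 : ℂ) • xm p 1
        else xp p i.1 + xp p (i.1 + 2)
    | .inl (.inr i) =>
        if i.1 + 1 = p then (2 : ℂ) • xm p (p - 1) + (2 : ℂ) • xp p 1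
        else xm p i.1 + xm p (i.1 + 2)
    | .inr i =>
        (br p i.1 / br p (i.1 + 1)) • gv p i.1
          + (br p (i.1 + 2) / br p (i.1 + 1)) • gv p (i.1 + 2)

/-- `J₁`: the span of the vectors `x⁺_s + x⁻_{p-s}` (1 ≤ s ≤ p-1), `x⁺_p` and `x⁻_p`. -/
def J1 (p : ℕ) : Submodule ℂ (GTA p) :=
  Submodule.span ℂ
    ((Set.range fun s : Fin (p - 1) => xp p (s.1 + 1) + xm p (p - (s.1 + 1)))
      ∪ {xp p p, xm p p})

/-- `J₂ = J₁ + span{x⁺_s : 1 ≤ s ≤ p-1}`. -/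
def J2 (p : ℕ) : Submodule ℂ (GTA p) :=
  J1 p ⊔ Submodule.span ℂ (Set.range fun s : Fin (p - 1) => xp p (s.1 + 1))

end

/-- Modulo `N`, the vectors `u a, …, u b` are eigenvectors of `A` with distinct eigenvalues `μ s`,
and `B` acts on them by an irreducible tridiagonal matrix. -/
structure IsTridiagonalModulo {K M : Type*} [Field K] [AddCommGroup M] [Module K M]
    (A B : Module.End K M) (N : Submodule K M) (a b : ℕ) (u : ℕ → M) (μ : ℕ → K) : Prop where
  eigen : ∀ s ∈ Set.Icc a b, A (u s) - μ s • u s ∈ N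
  injOn : Set.InjOn μ (Set.Icc a b)
  step : ∀ s ∈ Set.Icc a b, ∃ α β : K, B (u s) - (α • u (s - 1) + β • u (s + 1)) ∈ N ∧
    (α = 0 ↔ s = a) ∧ (β = 0 ↔ s = b)

/-- An invariant subspace containing a sum of eigenvectors with distinct eigenvalues contains
each of the summands. -/
theorem smul_mem_of_sum_smul_mem {K M : Type*} [Field K] [AddCommGroup M] [Module K M]
    {A : Module.End K M} {W : Submodule K M} (hA : ∀ v ∈ W, A v ∈ W) {u : ℕ → M} {μ : ℕ → K}
    (S : Finset ℕ) (hu : ∀ s ∈ S, A (u s) - μ s • u s ∈ W) (hμ : Set.InjOn μ S) (c : ℕ → K)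
    (hc : ∑ s ∈ S, c s • u s ∈ W) : ∀ s ∈ S, c s • u s ∈ W := by
  induction S using Finset.induction_on generalizing c with
  | empty => simp
  | insert t S ht ih =>
    have hS : ∀ s ∈ S, c s • u s ∈ W := by
      intro s hs
      have hne : μ s - μ t ≠ 0 := by
        refine sub_ne_zero.mpr fun h => ht ?_
        rw [← hμ (by simp [hs]) (by simp) h]
        exact hs
      have key := ih (fun s hs => hu s (Finset.mem_insert_of_mem hs))
        (hμ.mono (by simp)) (fun s => (μ s - μ t) * c s) ?_ s hs
      · have := W.smul_mem (μ s - μ t)⁻¹ key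
        rwa [smul_smul, ← mul_assoc, inv_mul_cancel₀ hne, one_mul] at this
      · have h₁ := W.sub_mem (hA _ hc) (W.smul_mem (μ t) hc)
        have h₂ : ∑ s ∈ insert t S, c s • (A (u s) - μ s • u s) ∈ W :=
          W.sum_mem fun s hs => W.smul_mem _ (hu s hs)
        have h₃ := W.sub_mem h₁ h₂
        convert h₃ using 1
        rw [map_sum, Finset.smul_sum, ← Finset.sum_sub_distrib, ← Finset.sum_sub_distrib,
          Finset.sum_insert ht]
        simp only [map_smul]
        rw [show c t • A (u t) - μ t • c t • u t - c t • (A (u t) - μ t • u t) = 0 by module,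
          zero_add]
        exact Finset.sum_congr rfl fun s _ => by module
    intro s hs
    rcases Finset.mem_insert.mp hs with rfl | hs
    · rw [Finset.sum_insert ht] at hc
      exact (W.add_mem_iff_left (W.sum_mem hS)).mp hc
    · exact hS s hs

namespace IsTridiagonalModulo

variable {K M : Type*} [Field K] [AddCommGroup M] [Module K M] {A B : Module.End K M}
  {N : Submodule K M} {a b : ℕ} {u : ℕ → M} {μ : ℕ → K}

theorem map_left_mem (h : IsTridiagonalModulo A B N a b u μ) (hN : ∀ v ∈ N, A v ∈ N) :
    ∀ v ∈ N ⊔ Submodule.span K (u '' Set.Icc a b),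
      A v ∈ N ⊔ Submodule.span K (u '' Set.Icc a b) := by
  set T := N ⊔ Submodule.span K (u '' Set.Icc a b) with hT
  have hNT : N ≤ T := le_sup_left
  have huT : ∀ s ∈ Set.Icc a b, u s ∈ T := fun s hs =>
    Submodule.mem_sup_right (Submodule.subset_span ⟨s, hs, rfl⟩)
  suffices T ≤ T.comap A from this
  refine sup_le (fun v hv => hNT (hN v hv)) (Submodule.span_le.mpr ?_)
  rintro _ ⟨s, hs, rfl⟩
  exact (T.sub_mem_iff_left (T.smul_mem _ (huT s hs))).mp (hNT (h.eigen s hs))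

theorem map_right_mem (h : IsTridiagonalModulo A B N a b u μ) (hN : ∀ v ∈ N, B v ∈ N) :
    ∀ v ∈ N ⊔ Submodule.span K (u '' Set.Icc a b),
      B v ∈ N ⊔ Submodule.span K (u '' Set.Icc a b) := by
  set T := N ⊔ Submodule.span K (u '' Set.Icc a b) with hT
  have hNT : N ≤ T := le_sup_left
  have huT : ∀ s ∈ Set.Icc a b, u s ∈ T := fun s hs =>
    Submodule.mem_sup_right (Submodule.subset_span ⟨s, hs, rfl⟩)
  suffices T ≤ T.comap B from this
  refine sup_le (fun v hv => hNT (hN v hv)) (Submodule.span_le.mpr ?_)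
  rintro _ ⟨s, hs, rfl⟩
  obtain ⟨α, β, hB, hα, hβ⟩ := h.step s hs
  refine (T.sub_mem_iff_left (T.add_mem ?_ ?_)).mp (hNT hB)
  · by_cases hsa : s = a
    · simp [hα.mpr hsa]
    · exact T.smul_mem _ (huT _ ⟨by have := hs.1; omega, by have := hs.2; omega⟩)
  · by_cases hsb : s = b
    · simp [hβ.mpr hsb]
    · exact T.smul_mem _ (huT _ ⟨by have := hs.1; omega, by have := hs.2; omega⟩)

theorem neighbors_mem (h : IsTridiagonalModulo A B N a b u μ) {W : Submodule K M} (hNW : N ≤ W)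
    (hA : ∀ v ∈ W, A v ∈ W) (hB : ∀ v ∈ W, B v ∈ W) {s : ℕ} (hs : s ∈ Set.Icc a b)
    (hsW : u s ∈ W) : (a < s → u (s - 1) ∈ W) ∧ (s < b → u (s + 1) ∈ W) := by
  obtain ⟨hs₁, hs₂⟩ := hs
  obtain ⟨α, β, hBs, hα, hβ⟩ := h.step s ⟨hs₁, hs₂⟩
  have hsum : α • u (s - 1) + β • u (s + 1) ∈ W :=
    (W.sub_mem_iff_right (hB _ hsW)).mp (hNW hBs)
  have cancel : ∀ {γ : K} {v : M}, γ ≠ 0 → γ • v ∈ W → v ∈ W := fun hγ hv =>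
    (W.smul_mem_iff hγ).mp hv
  by_cases hsa : s = a
  · rw [hα.mpr hsa, zero_smul, zero_add] at hsum
    exact ⟨fun hlt => by omega, fun hlt => cancel (fun h0 => by have := hβ.mp h0; omega) hsum⟩
  by_cases hsb : s = b
  · rw [hβ.mpr hsb, zero_smul, add_zero] at hsum
    exact ⟨fun _ => cancel (fun h0 => hsa (hα.mp h0)) hsum, fun hlt => by omega⟩
  have hmem : ∀ t ∈ ({s - 1, s + 1} : Finset ℕ), t ∈ Set.Icc a b := by
    intro t ht
    rcases Finset.mem_insert.mp ht with rfl | ht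
    · exact ⟨by omega, by omega⟩
    · rw [Finset.mem_singleton.mp ht]
      exact ⟨by omega, by omega⟩
  have hne : s - 1 ≠ s + 1 := by omega
  have key := smul_mem_of_sum_smul_mem hA {s - 1, s + 1}
    (fun t ht => hNW (h.eigen t (hmem t ht))) (h.injOn.mono fun t ht => hmem t ht)
    (fun t => if t = s - 1 then α else β) (by simpa [Finset.sum_pair hne, hne.symm] using hsum)
  refine ⟨fun _ => cancel (fun h0 => hsa (hα.mp h0)) (by simpa using key (s - 1) (by simp)),
    fun _ => cancel (fun h0 => hsb (hβ.mp h0)) (by simpa [hne.symm] using key (s + 1) (by simp))⟩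

theorem eq_or_eq (h : IsTridiagonalModulo A B N a b u μ) {W : Submodule K M} (hNW : N ≤ W)
    (hW : W ≤ N ⊔ Submodule.span K (u '' Set.Icc a b))
    (hA : ∀ v ∈ W, A v ∈ W) (hB : ∀ v ∈ W, B v ∈ W) :
    W = N ∨ W = N ⊔ Submodule.span K (u '' Set.Icc a b) := by
  by_cases hex : ∃ s ∈ Set.Icc a b, u s ∈ W
  · right
    obtain ⟨s, hs, hsW⟩ := hex
    refine le_antisymm hW (sup_le hNW (Submodule.span_le.mpr ?_))
    have up : ∀ k, s + k ≤ b → u (s + k) ∈ W := by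
      intro k
      induction k with
      | zero => exact fun _ => hsW
      | succ k ih =>
        intro hk
        exact (h.neighbors_mem hNW hA hB ⟨by have := hs.1; omega, by omega⟩
          (ih (by omega))).2 (by omega)
    have down : ∀ k, a + k ≤ s → u (s - k) ∈ W := by
      intro k
      induction k with
      | zero => exact fun _ => hsW
      | succ k ih =>
        intro hk
        exact (h.neighbors_mem hNW hA hB ⟨by omega, by have := hs.2; omega⟩
          (ih (by omega))).1 (by omega)
    rintro _ ⟨t, ⟨hat, htb⟩, rfl⟩
    rcases le_total s t with hst | hst
    · have := up (t - s) (by omega)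
      rwa [Nat.add_sub_cancel' hst] at this
    · have := down (s - t) (by omega)
      rwa [Nat.sub_sub_self hst] at this
  · left
    push Not at hex
    refine le_antisymm (fun w hw => ?_) hNW
    obtain ⟨n, hn, v, hv, rfl⟩ := Submodule.mem_sup.mp (hW hw)
    rw [← Finset.coe_Icc, Submodule.mem_span_image_finset_iff_exists_fun'] at hv
    obtain ⟨c, rfl⟩ := hv
    have hsum := (W.add_mem_iff_right (hNW hn)).mp hw
    have key := smul_mem_of_sum_smul_mem hA (Finset.Icc a b)
      (fun t ht => hNW (h.eigen t (Finset.mem_Icc.mp ht)))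
      (by rw [Finset.coe_Icc]; exact h.injOn) c hsum
    have hc : ∀ t ∈ Finset.Icc a b, c t • u t = 0 := by
      intro t ht
      by_cases h0 : c t = 0
      · simp [h0]
      · exact absurd ((W.smul_mem_iff h0).mp (key t ht)) (hex t (Finset.mem_Icc.mp ht))
    rwa [Finset.sum_eq_zero hc, add_zero]

end IsTridiagonalModulo

theorem eps_pow_two_mul (p s : ℕ) :
    eps p ^ (2 * s) = Complex.exp (((Real.pi * s / p : ℝ) : ℂ) * Complex.I) := by
  rw [eps, ← Complex.exp_nat_mul]
  congr 1
  rcases eq_or_ne p 0 with rfl | hp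
  · simp
  · push_cast
    field_simp

theorem eps_inv_pow_two_mul (p s : ℕ) :
    (eps p)⁻¹ ^ (2 * s) = Complex.exp (-((Real.pi * s / p : ℝ) : ℂ) * Complex.I) := by
  rw [inv_pow, eps_pow_two_mul, ← Complex.exp_neg, neg_mul]

theorem eps_pow_add_inv_pow (p s : ℕ) :
    eps p ^ (2 * s) + (eps p)⁻¹ ^ (2 * s) = ((2 * Real.cos (Real.pi * s / p) : ℝ) : ℂ) := by
  rw [eps_pow_two_mul, eps_inv_pow_two_mul, ← Complex.two_cos]
  push_cast
  rfl

theorem eps_pow_sub_inv_pow (p s : ℕ) :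
    eps p ^ (2 * s) - (eps p)⁻¹ ^ (2 * s) =
      ((2 * Real.sin (Real.pi * s / p) : ℝ) : ℂ) * Complex.I := by
  rw [eps_pow_two_mul, eps_inv_pow_two_mul, Complex.exp_mul_I, Complex.exp_mul_I,
    Complex.cos_neg, Complex.sin_neg]
  push_cast
  ring

/-- The eigenvalue of `A` on `x⁺_s`. -/
noncomputable def eigA (p s : ℕ) : ℂ := -(eps p ^ (2 * s) + (eps p)⁻¹ ^ (2 * s))

theorem eigA_injOn {p : ℕ} (hp : 2 ≤ p) : Set.InjOn (eigA p) (Set.Icc 0 p) := by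
  intro s hs t ht hst
  have hp0 : (0 : ℝ) < p := by exact_mod_cast (by omega : 0 < p)
  simp only [eigA, eps_pow_add_inv_pow, neg_inj, Complex.ofReal_inj] at hst
  have mem : ∀ r ∈ Set.Icc 0 p, Real.pi * r / p ∈ Set.Icc 0 Real.pi := by
    intro r hr
    have hrp : (r : ℝ) ≤ p := by exact_mod_cast hr.2
    refine ⟨by positivity, ?_⟩
    rw [div_le_iff₀ hp0]
    gcongr
  have := Real.injOn_cos (mem s hs) (mem t ht) (by linarith)
  field_simp at this
  exact_mod_cast this

theorem eigA_sub {p s : ℕ} (hp : 2 ≤ p) (hs : s ≤ p) : eigA p (p - s) = -eigA p s := by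
  have hp0 : (p : ℝ) ≠ 0 := by exact_mod_cast (by omega : p ≠ 0)
  simp only [eigA, eps_pow_add_inv_pow]
  rw [Nat.cast_sub hs, show Real.pi * ((p : ℝ) - s) / p = Real.pi - Real.pi * s / p by
    field_simp, Real.cos_pi_sub]
  push_cast
  ring

theorem br_ne_zero {p s : ℕ} (hs : 1 ≤ s) (hsp : s < p) : br p s ≠ 0 := by
  have sin_pos : ∀ r : ℕ, 1 ≤ r → r < p → 0 < Real.sin (Real.pi * r / p) := by
    intro r hr hrp
    have h₁ : (1 : ℝ) ≤ r := by exact_mod_cast hr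
    have h₂ : (r : ℝ) < p := by exact_mod_cast hrp
    have := Real.pi_pos
    refine Real.sin_pos_of_pos_of_lt_pi (div_pos (by positivity) (by linarith)) ?_
    rw [div_lt_iff₀ (by linarith)]
    gcongr
  have ne : ∀ r : ℕ, 1 ≤ r → r < p → eps p ^ (2 * r) - (eps p)⁻¹ ^ (2 * r) ≠ 0 := by
    intro r hr hrp
    rw [eps_pow_sub_inv_pow]
    exact mul_ne_zero (Complex.ofReal_ne_zero.mpr
      (mul_ne_zero two_ne_zero (sin_pos r hr hrp).ne')) Complex.I_ne_zero
  exact div_ne_zero (ne s hs hsp) (ne 1 le_rfl (by omega))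

@[simp] theorem xp_zero (p : ℕ) : xp p 0 = 0 := by simp [xp]

@[simp] theorem xm_zero (p : ℕ) : xm p 0 = 0 := by simp [xm]

theorem Aop_xp (p s : ℕ) : Aop p (xp p s) = eigA p s • xp p s := by
  by_cases h : 1 ≤ s ∧ s ≤ p
  · obtain ⟨t, rfl⟩ : ∃ t, s = t + 1 := ⟨s - 1, by omega⟩
    conv_lhs => rw [xp, dif_pos h]
    rw [← Pi.basisFun_apply, Aop, Module.Basis.constr_basis]
    rfl
  · simp [xp, dif_neg h]

theorem Aop_xm (p s : ℕ) : Aop p (xm p s) = -eigA p s • xm p s := by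
  by_cases h : 1 ≤ s ∧ s ≤ p
  · obtain ⟨t, rfl⟩ : ∃ t, s = t + 1 := ⟨s - 1, by omega⟩
    conv_lhs => rw [xm, dif_pos h]
    rw [← Pi.basisFun_apply, Aop, Module.Basis.constr_basis, eigA, neg_neg]
    rfl
  · simp [xm, dif_neg h]

theorem Aop_gv {p s : ℕ} (hs : 1 ≤ s) (hsp : s ≤ p - 1) :
    Aop p (gv p s) = eigA p s • gv p s -
      ((eps p ^ 2 - (eps p)⁻¹ ^ 2) ^ 2) • (xp p s + xm p (p - s)) := by
  obtain ⟨t, rfl⟩ : ∃ t, s = t + 1 := ⟨s - 1, by omega⟩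
  conv_lhs => rw [gv, dif_pos ⟨hs, hsp⟩]
  rw [← Pi.basisFun_apply, Aop, Module.Basis.constr_basis]
  rfl

theorem Bop_xp {p s : ℕ} (hs : 1 ≤ s) (hsp : s < p) :
    Bop p (xp p s) = xp p (s - 1) + xp p (s + 1) := by
  obtain ⟨t, rfl⟩ : ∃ t, s = t + 1 := ⟨s - 1, by omega⟩
  conv_lhs => rw [xp, dif_pos ⟨hs, hsp.le⟩]
  rw [← Pi.basisFun_apply, Bop, Module.Basis.constr_basis]
  exact if_neg hsp.ne

theorem Bop_xm {p s : ℕ} (hs : 1 ≤ s) (hsp : s < p) :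
    Bop p (xm p s) = xm p (s - 1) + xm p (s + 1) := by
  obtain ⟨t, rfl⟩ : ∃ t, s = t + 1 := ⟨s - 1, by omega⟩
  conv_lhs => rw [xm, dif_pos ⟨hs, hsp.le⟩]
  rw [← Pi.basisFun_apply, Bop, Module.Basis.constr_basis]
  exact if_neg hsp.ne

theorem Bop_xp_self {p : ℕ} (hp : 1 ≤ p) :
    Bop p (xp p p) = (2 : ℂ) • xp p (p - 1) + (2 : ℂ) • xm p 1 := by
  conv_lhs => rw [xp, dif_pos ⟨hp, le_rfl⟩]
  rw [← Pi.basisFun_apply, Bop, Module.Basis.constr_basis]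
  exact if_pos (Nat.sub_add_cancel hp)

theorem Bop_xm_self {p : ℕ} (hp : 1 ≤ p) :
    Bop p (xm p p) = (2 : ℂ) • xm p (p - 1) + (2 : ℂ) • xp p 1 := by
  conv_lhs => rw [xm, dif_pos ⟨hp, le_rfl⟩]
  rw [← Pi.basisFun_apply, Bop, Module.Basis.constr_basis]
  exact if_pos (Nat.sub_add_cancel hp)

theorem Bop_gv {p s : ℕ} (hs : 1 ≤ s) (hsp : s ≤ p - 1) :
    Bop p (gv p s) = (br p (s - 1) / br p s) • gv p (s - 1) +
      (br p (s + 1) / br p s) • gv p (s + 1) := by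
  obtain ⟨t, rfl⟩ : ∃ t, s = t + 1 := ⟨s - 1, by omega⟩
  conv_lhs => rw [gv, dif_pos ⟨hs, hsp⟩]
  rw [← Pi.basisFun_apply, Bop, Module.Basis.constr_basis]
  rfl

/-- The characters of the projective modules: `x⁻_p`, then `x⁺_s + x⁻_{p-s}`, then `x⁺_p`. -/
def projChar (p s : ℕ) : GTA p := xp p s + xm p (p - s)

theorem J1_eq {p : ℕ} (hp : 2 ≤ p) :
    J1 p = ⊥ ⊔ Submodule.span ℂ (projChar p '' Set.Icc 0 p) := by
  rw [bot_sup_eq, J1]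
  congr 1
  ext v
  constructor
  · rintro (⟨s, rfl⟩ | rfl | rfl)
    · exact ⟨s.1 + 1, ⟨by omega, by omega⟩, rfl⟩
    · exact ⟨p, ⟨by omega, le_rfl⟩, by simp [projChar]⟩
    · exact ⟨0, ⟨le_rfl, by omega⟩, by simp [projChar]⟩
  · rintro ⟨s, ⟨-, hs⟩, rfl⟩
    by_cases h0 : s = 0
    · subst h0
      right; right
      simp [projChar]
    by_cases hsp : s = p
    · subst hsp
      right; left
      simp [projChar]
    · left
      exact ⟨⟨s - 1, by omega⟩, by simp [projChar, Nat.sub_add_cancel (by omega : 1 ≤ s)]⟩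

theorem projChar_mem_J1 {p s : ℕ} (hp : 2 ≤ p) (hs : s ≤ p) : projChar p s ∈ J1 p := by
  rw [J1_eq hp]
  exact Submodule.mem_sup_right (Submodule.subset_span ⟨s, ⟨Nat.zero_le _, hs⟩, rfl⟩)

theorem J2_eq (p : ℕ) :
    J2 p = J1 p ⊔ Submodule.span ℂ (xp p '' Set.Icc 1 (p - 1)) := by
  rw [J2]
  congr 2
  ext v
  constructor
  · rintro ⟨s, rfl⟩
    exact ⟨s.1 + 1, ⟨by omega, by omega⟩, rfl⟩
  · rintro ⟨s, ⟨h₁, h₂⟩, rfl⟩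
    exact ⟨⟨s - 1, by omega⟩, by simp [Nat.sub_add_cancel h₁]⟩

theorem xp_mem_J2 {p s : ℕ} (hp : 2 ≤ p) (hs : s ≤ p) : xp p s ∈ J2 p := by
  rw [J2_eq]
  by_cases h0 : s = 0
  · simp [h0]
  by_cases hsp : s = p
  · refine Submodule.mem_sup_left ?_
    simpa [projChar, hsp] using projChar_mem_J1 hp (le_refl p)
  · exact Submodule.mem_sup_right (Submodule.subset_span ⟨s, ⟨by omega, by omega⟩, rfl⟩)

theorem xm_mem_J2 {p s : ℕ} (hp : 2 ≤ p) (hs : s ≤ p) : xm p s ∈ J2 p := by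
  have h₁ : projChar p (p - s) ∈ J2 p :=
    (le_sup_left : J1 p ≤ J2 p) (projChar_mem_J1 hp (Nat.sub_le _ _))
  rw [projChar, Nat.sub_sub_self hs] at h₁
  exact (Submodule.add_mem_iff_right _ (xp_mem_J2 hp (Nat.sub_le _ _))).mp h₁

theorem top_eq {p : ℕ} (hp : 2 ≤ p) :
    (⊤ : Submodule ℂ (GTA p)) = J2 p ⊔ Submodule.span ℂ (gv p '' Set.Icc 1 (p - 1)) := by
  refine le_antisymm ?_ le_top
  rw [← (Pi.basisFun ℂ (GTAIdx p)).span_eq, Submodule.span_le]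
  rintro _ ⟨(i | i) | i, rfl⟩
  · refine Submodule.mem_sup_left ?_
    have := xp_mem_J2 hp (by omega : i.1 + 1 ≤ p)
    rw [xp, dif_pos ⟨by omega, by omega⟩] at this
    simpa using this
  · refine Submodule.mem_sup_left ?_
    have := xm_mem_J2 hp (by omega : i.1 + 1 ≤ p)
    rw [xm, dif_pos ⟨by omega, by omega⟩] at this
    simpa using this
  · refine Submodule.mem_sup_right (Submodule.subset_span ⟨i.1 + 1, ⟨by omega, by omega⟩, ?_⟩)
    rw [gv, dif_pos ⟨by omega, by omega⟩]
    simp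

theorem isTridiagonalModulo_projChar {p : ℕ} (hp : 2 ≤ p) :
    IsTridiagonalModulo (Aop p) (Bop p) ⊥ 0 p (projChar p) (eigA p) where
  eigen s hs := by
    rw [Submodule.mem_bot, projChar, map_add, Aop_xp, Aop_xm, eigA_sub hp hs.2]
    module
  injOn := eigA_injOn hp
  step s hs := by
    obtain ⟨-, hs⟩ := hs
    simp only [Submodule.mem_bot, sub_eq_zero, projChar]
    by_cases h0 : s = 0
    · subst h0
      refine ⟨0, 2, ?_, by simp, by simp; omega⟩
      simp only [xp_zero, Nat.sub_zero, zero_add, zero_smul]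
      rw [Bop_xm_self (by omega), smul_add, add_comm]
    by_cases hsp : s = p
    · subst hsp
      refine ⟨2, 0, ?_, by simp; omega, by simp⟩
      simp only [xm_zero, Nat.sub_self, add_zero, zero_smul]
      rw [Bop_xp_self (by omega), smul_add, Nat.sub_sub_self (by omega)]
    · refine ⟨1, 1, ?_, by simp [h0], by simp [hsp]⟩
      rw [map_add, Bop_xp (by omega) (by omega), Bop_xm (by omega) (by omega),
        show p - s - 1 = p - (s + 1) by omega, show p - s + 1 = p - (s - 1) by omega]
      module

theorem isTridiagonalModulo_xp {p : ℕ} (hp : 2 ≤ p) :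
    IsTridiagonalModulo (Aop p) (Bop p) (J1 p) 1 (p - 1) (xp p) (eigA p) where
  eigen s _ := by simp [Aop_xp]
  injOn := (eigA_injOn hp).mono (Set.Icc_subset_Icc (by omega) (by omega))
  step s hs := by
    obtain ⟨hs₁, hs₂⟩ := hs
    refine ⟨if s = 1 then 0 else 1, if s = p - 1 then 0 else 1, ?_, by simp, by simp⟩
    have hlow : (if s = 1 then (0 : ℂ) else 1) • xp p (s - 1) = xp p (s - 1) := by
      split_ifs with h
      · simp [h]
      · exact one_smul _ _
    rw [Bop_xp hs₁ (by omega), hlow, add_sub_add_left_eq_sub]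
    split_ifs with h
    · have := projChar_mem_J1 hp (le_refl p)
      simpa [projChar, h, Nat.sub_add_cancel (by omega : 1 ≤ p)] using this
    · simp

theorem isTridiagonalModulo_gv {p : ℕ} (hp : 2 ≤ p) :
    IsTridiagonalModulo (Aop p) (Bop p) (J2 p) 1 (p - 1) (gv p) (eigA p) where
  eigen s hs := by
    rw [Aop_gv hs.1 hs.2, sub_sub_cancel_left]
    exact neg_mem (Submodule.smul_mem _ _
      (add_mem (xp_mem_J2 hp (by have := hs.2; omega)) (xm_mem_J2 hp (Nat.sub_le _ _))))
  injOn := (eigA_injOn hp).mono (Set.Icc_subset_Icc (by omega) (by omega))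
  step s hs := by
    obtain ⟨hs₁, hs₂⟩ := hs
    have hs₀ : br p s ≠ 0 := br_ne_zero hs₁ (by omega)
    refine ⟨br p (s - 1) / br p s, if s = p - 1 then 0 else br p (s + 1) / br p s, ?_, ?_, ?_⟩
    · rw [Bop_gv hs₁ hs₂, add_sub_add_left_eq_sub]
      split_ifs with h
      · simp [gv, h]
      · simp
    · constructor
      · intro h
        by_contra hne
        exact div_ne_zero (br_ne_zero (by omega) (by omega)) hs₀ h
      · rintro rfl
        simp [br]
    · split_ifs with h
      · simp [h]
      · simpa [h] using ⟨br_ne_zero (by omega) (by omega), hs₀⟩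

theorem bot_lt_J1 {p : ℕ} (hp : 2 ≤ p) : ⊥ < J1 p := by
  refine bot_lt_iff_ne_bot.mpr fun h => ?_
  have hmem := projChar_mem_J1 hp (le_refl p)
  rw [h, Submodule.mem_bot] at hmem
  have := congrFun hmem (.inl (.inl ⟨p - 1, by omega⟩))
  simp [projChar, xp, show 1 ≤ p by omega] at this

theorem J1_lt_J2 {p : ℕ} (hp : 2 ≤ p) : J1 p < J2 p := by
  refine lt_of_le_of_ne le_sup_left fun h => ?_
  have hmem : xp p 1 ∈ J1 p := h ▸ xp_mem_J2 hp (by omega)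
  let f : GTA p →ₗ[ℂ] ℂ :=
    LinearMap.proj (.inl (.inl ⟨0, by omega⟩)) - LinearMap.proj (.inl (.inr ⟨p - 2, by omega⟩))
  have hf : J1 p ≤ LinearMap.ker f := by
    rw [J1, Submodule.span_le]
    rintro _ (⟨s, rfl⟩ | rfl | rfl)
    · have hs := s.2
      have h₁ : xp p (s.1 + 1) (.inl (.inl ⟨0, by omega⟩)) = if s.1 = 0 then 1 else 0 := by
        rw [xp, dif_pos ⟨by omega, by omega⟩]
        simp [Pi.single_apply, eq_comm]
      have h₂ : xm p (p - (s.1 + 1)) (.inl (.inr ⟨p - 2, by omega⟩)) =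
          if s.1 = 0 then 1 else 0 := by
        rw [xm, dif_pos ⟨by omega, by omega⟩, Pi.single_apply]
        refine if_congr ?_ rfl rfl
        simp only [Sum.inl.injEq, Sum.inr.injEq, Fin.mk.injEq]
        omega
      have h₃ : xp p (s.1 + 1) (.inl (.inr ⟨p - 2, by omega⟩)) = 0 := by
        rw [xp, dif_pos ⟨by omega, by omega⟩]
        simp
      have h₄ : xm p (p - (s.1 + 1)) (.inl (.inl ⟨0, by omega⟩)) = 0 := by
        rw [xm, dif_pos ⟨by omega, by omega⟩]
        simp
      simp [f, h₁, h₂, h₃, h₄]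
    · have : (0 : ℕ) ≠ p - 1 := by omega
      simp [f, xp, this, show 1 ≤ p by omega]
    · have : p - 2 ≠ p - 1 := by omega
      simp [f, xm, this, show 1 ≤ p by omega]
  have := hf hmem
  simp [f, xp, show 1 ≤ p by omega] at this

theorem J2_lt_top {p : ℕ} (hp : 2 ≤ p) : J2 p < ⊤ := by
  refine lt_top_iff_ne_top.mpr fun h => ?_
  let f : GTA p →ₗ[ℂ] ℂ := LinearMap.proj (.inr ⟨0, by omega⟩)
  have hxp : ∀ s, f (xp p s) = 0 := by
    intro s
    by_cases hs : 1 ≤ s ∧ s ≤ p <;> simp [f, xp, hs]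
  have hxm : ∀ s, f (xm p s) = 0 := by
    intro s
    by_cases hs : 1 ≤ s ∧ s ≤ p <;> simp [f, xm, hs]
  have hf : J2 p ≤ LinearMap.ker f := by
    rw [J2, J1]
    refine sup_le (Submodule.span_le.mpr ?_) (Submodule.span_le.mpr ?_)
    · rintro _ (⟨s, rfl⟩ | rfl | rfl) <;> simp [hxp, hxm]
    · rintro _ ⟨s, rfl⟩
      simp [hxp]
  have := hf (h ▸ Submodule.mem_top : gv p 1 ∈ J2 p)
  simp [f, gv, show 1 ≤ p - 1 by omega] at this

/-- the factor `V/J₂` is simple under the two operators `A`, `B`, and consequently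
(together with invariance and simplicity of the lower factors) `0 ⊂ J₁ ⊂ J₂ ⊂ V` is a
composition series of `V` for the algebra generated by `A` and `B`. -/
theorem stmt13 (p : ℕ) (hp : 2 ≤ p) :
    (∀ W : Submodule ℂ (GTA p), J2 p ≤ W →
      (∀ v ∈ W, Aop p v ∈ W) → (∀ v ∈ W, Bop p v ∈ W) →
      W = J2 p ∨ W = ⊤) ∧
    -- strict chain 0 ⊂ J₁ ⊂ J₂ ⊂ V
    (⊥ < J1 p ∧ J1 p < J2 p ∧ J2 p < (⊤ : Submodule ℂ (GTA p))) ∧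
    -- J₁ and J₂ are invariant under A and B
    ((∀ v ∈ J1 p, Aop p v ∈ J1 p) ∧ (∀ v ∈ J1 p, Bop p v ∈ J1 p) ∧
     (∀ v ∈ J2 p, Aop p v ∈ J2 p) ∧ (∀ v ∈ J2 p, Bop p v ∈ J2 p)) ∧
    -- simplicity of the lower factors
    (∀ W : Submodule ℂ (GTA p), W ≤ J1 p →
      (∀ v ∈ W, Aop p v ∈ W) → (∀ v ∈ W, Bop p v ∈ W) → W = ⊥ ∨ W = J1 p) ∧
    (∀ W : Submodule ℂ (GTA p), J1 p ≤ W → W ≤ J2 p →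
      (∀ v ∈ W, Aop p v ∈ W) → (∀ v ∈ W, Bop p v ∈ W) → W = J1 p ∨ W = J2 p) := by
  have hJ1A : ∀ v ∈ J1 p, Aop p v ∈ J1 p := by
    rw [J1_eq hp]
    exact (isTridiagonalModulo_projChar hp).map_left_mem (by simp)
  have hJ1B : ∀ v ∈ J1 p, Bop p v ∈ J1 p := by
    rw [J1_eq hp]
    exact (isTridiagonalModulo_projChar hp).map_right_mem (by simp)
  refine ⟨fun W hW hA hB => ?_, ⟨bot_lt_J1 hp, J1_lt_J2 hp, J2_lt_top hp⟩,
    ⟨hJ1A, hJ1B, ?_, ?_⟩, fun W hW hA hB => ?_, fun W hW hW' hA hB => ?_⟩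
  · rw [top_eq hp]
    exact (isTridiagonalModulo_gv hp).eq_or_eq hW (top_eq hp ▸ le_top) hA hB
  · rw [J2_eq]
    exact (isTridiagonalModulo_xp hp).map_left_mem hJ1A
  · rw [J2_eq]
    exact (isTridiagonalModulo_xp hp).map_right_mem hJ1B
  · rw [J1_eq hp] at hW ⊢
    exact (isTridiagonalModulo_projChar hp).eq_or_eq bot_le hW hA hB
  · rw [J2_eq] at hW' ⊢
    exact (isTridiagonalModulo_xp hp).eq_or_eq hW hW' hA hB
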